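/- Let m, N be positive integers, α, β ∈ (0,1), let S_1,…,S_m be real numbers and S̃_1,…,S̃_N be pairwise distinct real numbers, and let η ∈ ℝ. Then the following deterministic implications hold: (i) if R_{r_η}^+ ≤ ⌈(1−α)(N+1)⌉ (equivalently, U_m(r_η) ≤ Q̃_{1−α}), then T(η) ≤ Q̃_{1−α}; and (ii) if T(η) ≤ Q̃_{1−α}, then R_{r_η}^− ≤ ⌈(1−α)(N+1)⌉ (equivalently, L_m(r_η) ≤ Q̃_{1−α}). -/

import Mathlib

open MeasureTheory ProbabilityTheory Finset

noncomputable section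

/-- The `r`-th order statistic (0-indexed) of a finite tuple of reals: the values
sorted in increasing order. -/
def orderStat {n : ℕ} (f : Fin n → ℝ) : Fin n → ℝ := f ∘ Tuple.sort f

/-- The probability mass function `p_{m,N,r}(k)` of the `r`-th order statistic of a
sample of size `m+1` drawn without replacement from a population of size `N+m+1`. -/
def pWindow (m N r k : ℕ) : ℝ :=
  (((k + r - 2).choose (r - 1) * (N + m + 2 - k - r).choose (m + 1 - r) : ℕ) : ℝ) /
    (((N + m + 1).choose (m + 1) : ℕ) : ℝ)

/-- `F_{m,N,r}(t) = Σ_{k=1}^t p_{m,N,r}(k)`, with `F(0) = 0`. -/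
def Fwindow (m N r t : ℕ) : ℝ := ∑ k ∈ Finset.Icc 1 t, pWindow m N r k

/-- `R_r^- = max {t ∈ {1,…,N+1} : F_{m,N,r}(t-1) ≤ β/2}`. -/
def Rminus (m N : ℕ) (β : ℝ) (r : ℕ) : ℕ :=
  sSup {t | t ∈ Finset.Icc 1 (N + 1) ∧ Fwindow m N r (t - 1) ≤ β / 2}

/-- `R_r^+ = min {t ∈ {1,…,N+1} : F_{m,N,r}(t) ≥ 1 - β/2}`. -/
def Rplus (m N : ℕ) (β : ℝ) (r : ℕ) : ℕ :=
  sInf {t | t ∈ Finset.Icc 1 (N + 1) ∧ 1 - β / 2 ≤ Fwindow m N r t}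

/-- `S̃_{(t)}`, the `t`-th smallest synthetic score for `t ∈ {1,…,N}`, with the
convention `S̃_{(N+1)} = +∞` (value in `EReal`). -/
def synthSorted (N : ℕ) (g : Fin N → ℝ) (t : ℕ) : EReal :=
  if h : 1 ≤ t ∧ t ≤ N then ((orderStat g ⟨t - 1, by omega⟩ : ℝ) : EReal) else ⊤

/-- The lower window endpoint `L_m(r) = S̃_{(R_r^-)}`. -/
def windowLo (m N : ℕ) (β : ℝ) (g : Fin N → ℝ) (r : ℕ) : EReal :=
  synthSorted N g (Rminus m N β r)

/-- The upper window endpoint `U_m(r) = S̃_{(R_r^+)}`. -/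
def windowHi (m N : ℕ) (β : ℝ) (g : Fin N → ℝ) (r : ℕ) : EReal :=
  synthSorted N g (Rplus m N β r)

/-- The rank `r_η = 1 + #{i : S_i < η}` of `η` among the real calibration scores. -/
def rankOf (m : ℕ) (S : Fin m → ℝ) (η : ℝ) : ℕ :=
  1 + (Finset.univ.filter fun i => S i < η).card

/-- The lower nearest neighbor `NN_m^-(r,η)`: the largest synthetic order statistic
`S̃_{(j)}` with `R_r^- ≤ j ≤ R_r^+` and `S̃_{(j)} ≤ η`. -/
def NNminus (m N : ℕ) (β : ℝ) (g : Fin N → ℝ) (r : ℕ) (η : ℝ) : EReal :=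
  sSup {x : EReal | ∃ j : ℕ, Rminus m N β r ≤ j ∧ j ≤ Rplus m N β r ∧
    x = synthSorted N g j ∧ x ≤ (η : EReal)}

/-- The score transporter `T`. -/
def transport (m N : ℕ) (β : ℝ) (S : Fin m → ℝ) (g : Fin N → ℝ) (η : ℝ) : EReal :=
  if windowHi m N β g (rankOf m S η) ≤ (η : EReal) then windowHi m N β g (rankOf m S η)
  else if windowLo m N β g (rankOf m S η) ≤ (η : EReal) then NNminus m N β g (rankOf m S η) η
  else windowLo m N β g (rankOf m S η)

/-- The quantile index `⌈(1-α)(N+1)⌉`. -/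
def qIdx (N : ℕ) (α : ℝ) : ℕ := ⌈(1 - α) * ((N : ℝ) + 1)⌉₊

/-- `Q̃_{1-α}`, the `⌈(1-α)(N+1)⌉`-th smallest synthetic score (`+∞` if the index is `N+1`). -/
def synthQuantile (N : ℕ) (g : Fin N → ℝ) (α : ℝ) : EReal := synthSorted N g (qIdx N α)

/-- `S_{(t)}` for the real calibration scores, `t ∈ {1,…,m}`, with the conventions
`S_{(m+1)} = +∞` and `-∞` for out-of-range indices (e.g. an empty maximum). -/
def realSorted (m : ℕ) (S : Fin m → ℝ) (t : ℕ) : EReal :=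
  if h : 1 ≤ t ∧ t ≤ m then ((orderStat S ⟨t - 1, by omega⟩ : ℝ) : EReal)
  else if t = m + 1 then ⊤ else ⊥

/-- Total variation distance between two (probability) measures on `ℝ`. -/
def tvDist (μ ν : Measure ℝ) : ℝ :=
  ⨆ A : {s : Set ℝ // MeasurableSet s}, |(μ A.1).toReal - (ν A.1).toReal|

/-- The law of the `i`-th order statistic of `n` i.i.d. draws from `P`. -/
def orderStatLaw (n : ℕ) (P : Measure ℝ) (i : Fin n) : Measure ℝ :=
  (Measure.pi fun _ : Fin n => P).map fun f => orderStat f i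

end

/-- The convolution of two columns of Pascal's triangle is a column of Pascal's triangle. -/
theorem sum_antidiagonal_choose_mul_choose (a b n : ℕ) :
    ∑ ij ∈ antidiagonal n, (a + ij.1).choose a * (b + ij.2).choose b =
      (a + b + 1 + n).choose (a + b + 1) := by
  have h := congrArg (PowerSeries.coeff n)
    (pow_add (PowerSeries.mk 1 : PowerSeries ℤ) (a + 1) (b + 1))
  rw [show a + 1 + (b + 1) = (a + b + 1) + 1 by omega,
    PowerSeries.mk_one_pow_eq_mk_choose_add, PowerSeries.mk_one_pow_eq_mk_choose_add,
    PowerSeries.mk_one_pow_eq_mk_choose_add, PowerSeries.coeff_mul] at h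
  simp only [PowerSeries.coeff_mk] at h
  exact_mod_cast h.symm

theorem pWindow_nonneg (m N r k : ℕ) : 0 ≤ pWindow m N r k := by
  unfold pWindow
  positivity

theorem Fwindow_mono (m N r : ℕ) : Monotone (Fwindow m N r) := fun _ _ hst =>
  Finset.sum_le_sum_of_subset_of_nonneg (Finset.Icc_subset_Icc_right hst)
    fun k _ _ => pWindow_nonneg m N r k

/-- The weights `p_{m,N,r}(k)`, `1 ≤ k ≤ N + 1`, sum to one. -/
theorem Fwindow_last (m N r : ℕ) (hr : 1 ≤ r) (hrm : r ≤ m + 1) :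
    Fwindow m N r (N + 1) = 1 := by
  have hsum : ∑ k ∈ Finset.Icc 1 (N + 1),
      (k + r - 2).choose (r - 1) * (N + m + 2 - k - r).choose (m + 1 - r) =
        (N + m + 1).choose (m + 1) := by
    have h := sum_antidiagonal_choose_mul_choose (r - 1) (m + 1 - r) N
    rw [Finset.Nat.sum_antidiagonal_eq_sum_range_succ_mk] at h
    rw [show r - 1 + (m + 1 - r) + 1 = m + 1 by omega,
      show m + 1 + N = N + m + 1 by omega] at h
    rw [← h, ← Finset.Ico_add_one_right_eq_Icc, Finset.sum_Ico_eq_sum_range]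
    refine Finset.sum_congr rfl fun k hk => ?_
    have hk' := Finset.mem_range.mp hk
    congr 2 <;> omega
  have hpos : (((N + m + 1).choose (m + 1) : ℕ) : ℝ) ≠ 0 := by
    exact_mod_cast (Nat.choose_pos (by omega)).ne'
  unfold Fwindow pWindow
  rw [← Finset.sum_div, ← Nat.cast_sum, hsum, div_self hpos]

theorem Rminus_mem (m N r : ℕ) {β : ℝ} (hβ : 0 ≤ β) :
    Rminus m N β r ∈ Finset.Icc 1 (N + 1) ∧ Fwindow m N r (Rminus m N β r - 1) ≤ β / 2 :=
  Nat.sSup_mem (s := {t | t ∈ Finset.Icc 1 (N + 1) ∧ Fwindow m N r (t - 1) ≤ β / 2})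
    ⟨1, by simp, by simpa [Fwindow] using by positivity⟩
    ⟨N + 1, fun _ ht => (Finset.mem_Icc.mp ht.1).2⟩

theorem Rplus_mem (m N r : ℕ) {β : ℝ} (hβ : 0 ≤ β) (hr : 1 ≤ r) (hrm : r ≤ m + 1) :
    Rplus m N β r ∈ Finset.Icc 1 (N + 1) ∧ 1 - β / 2 ≤ Fwindow m N r (Rplus m N β r) :=
  Nat.sInf_mem (s := {t | t ∈ Finset.Icc 1 (N + 1) ∧ 1 - β / 2 ≤ Fwindow m N r t})
    ⟨N + 1, by simp, by rw [Fwindow_last m N r hr hrm]; linarith⟩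

theorem Rminus_le_Rplus (m N r : ℕ) {β : ℝ} (hβ : β ∈ Set.Ioo (0 : ℝ) 1) (hr : 1 ≤ r)
    (hrm : r ≤ m + 1) : Rminus m N β r ≤ Rplus m N β r := by
  have h₁ := (Rminus_mem m N r hβ.1.le).2
  have h₂ := (Rplus_mem m N r hβ.1.le hr hrm).2
  by_contra! hlt
  have h₃ := Fwindow_mono m N r (Nat.le_sub_one_of_lt hlt)
  linarith [hβ.2]

theorem synthSorted_mono {N : ℕ} (g : Fin N → ℝ) {s t : ℕ} (hs : 1 ≤ s) (hst : s ≤ t) :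
    synthSorted N g s ≤ synthSorted N g t := by
  unfold synthSorted
  by_cases ht : t ≤ N
  · rw [dif_pos ⟨hs, hst.trans ht⟩, dif_pos ⟨hs.trans hst, ht⟩, EReal.coe_le_coe_iff]
    exact Tuple.monotone_sort g (Fin.mk_le_mk.mpr (Nat.sub_le_sub_right hst 1))
  · rw [dif_neg fun h : 1 ≤ t ∧ t ≤ N => ht h.2]
    exact le_top

theorem synthSorted_strictMono {N : ℕ} {g : Fin N → ℝ} (hg : Function.Injective g) {s t : ℕ}
    (hs : 1 ≤ s) (hst : s < t) (ht : t ≤ N + 1) : synthSorted N g s < synthSorted N g t := by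
  unfold synthSorted
  rw [dif_pos ⟨hs, by omega⟩]
  split_ifs with h
  · rw [EReal.coe_lt_coe_iff]
    exact (Tuple.monotone_sort g).strictMono_of_injective
      (hg.comp (Tuple.sort g).injective) (Fin.mk_lt_mk.mpr (by omega))
  · exact EReal.coe_lt_top _

theorem one_le_qIdx (N : ℕ) {α : ℝ} (hα : α < 1) : 1 ≤ qIdx N α :=
  Nat.ceil_pos.mpr (mul_pos (by linarith) (by positivity))

theorem rankOf_le (m : ℕ) (S : Fin m → ℝ) (η : ℝ) : rankOf m S η ≤ m + 1 := by
  have h := Finset.card_le_univ (Finset.univ.filter fun i => S i < η)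
  rw [Fintype.card_fin] at h
  unfold rankOf
  omega

theorem windowLo_le_windowHi (m N r : ℕ) {β : ℝ} (g : Fin N → ℝ) (hβ : β ∈ Set.Ioo (0 : ℝ) 1)
    (hr : 1 ≤ r) (hrm : r ≤ m + 1) : windowLo m N β g r ≤ windowHi m N β g r :=
  synthSorted_mono g (Finset.mem_Icc.mp (Rminus_mem m N r hβ.1.le).1).1
    (Rminus_le_Rplus m N r hβ hr hrm)

/-- The transported score lies in the window `[L_m(r_η), U_m(r_η)]`. -/
theorem transport_mem_Icc (m N : ℕ) {β : ℝ} (hβ : β ∈ Set.Ioo (0 : ℝ) 1) (S : Fin m → ℝ)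
    (g : Fin N → ℝ) (η : ℝ) :
    transport m N β S g η ∈
      Set.Icc (windowLo m N β g (rankOf m S η)) (windowHi m N β g (rankOf m S η)) := by
  have hr : 1 ≤ rankOf m S η := Nat.le_add_right 1 _
  have hrm := rankOf_le m S η
  have hle := windowLo_le_windowHi m N _ g hβ hr hrm
  unfold transport
  split_ifs with hhi hlo
  · exact ⟨hle, le_rfl⟩
  · exact ⟨le_sSup ⟨_, le_rfl, Rminus_le_Rplus m N _ hβ hr hrm, rfl, hlo⟩,
      sSup_le fun x ⟨_, _, _, _, hx⟩ => hx.trans (not_le.mp hhi).le⟩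
  · exact ⟨le_rfl, hle⟩

/-- the deterministic sandwich used in the worst-case bounds.
(i) If `R_{r_η}^+ ≤ ⌈(1−α)(N+1)⌉` then `T(η) ≤ Q̃_{1−α}`;
(ii) if `T(η) ≤ Q̃_{1−α}` then `R_{r_η}^- ≤ ⌈(1−α)(N+1)⌉`. -/
theorem transport_coverage_sandwich
    (m N : ℕ) (hm : 0 < m) (hN : 0 < N)
    (α β : ℝ) (hα : α ∈ Set.Ioo (0 : ℝ) 1) (hβ : β ∈ Set.Ioo (0 : ℝ) 1)
    (S : Fin m → ℝ) (G : Fin N → ℝ) (hG : Function.Injective G) (η : ℝ) :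
    (Rplus m N β (rankOf m S η) ≤ qIdx N α →
        transport m N β S G η ≤ synthQuantile N G α) ∧
      (transport m N β S G η ≤ synthQuantile N G α →
        Rminus m N β (rankOf m S η) ≤ qIdx N α) := by
  have hT := transport_mem_Icc m N hβ S G η
  refine ⟨fun h => ?_, fun h => ?_⟩
  · have hR := Rplus_mem m N _ hβ.1.le (Nat.le_add_right 1 _) (rankOf_le m S η)
    exact hT.2.trans (synthSorted_mono G (Finset.mem_Icc.mp hR.1).1 h)
  · by_contra! hlt
    have hR := Rminus_mem m N (rankOf m S η) hβ.1.le
    exact (hT.1.trans h).not_gt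
      (synthSorted_strictMono hG (one_le_qIdx N hα.2) hlt (Finset.mem_Icc.mp hR.1).2)
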